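/- Let A and C be Appell sequences and let u = (u_n)_{n≥0}, v = (v_n)_{n≥0} be real sequences. Then for every n ≥ 0 and every real x: (L_u (L_v (A×C)))_n(x) = (L_v (L_u (A×C)))_n(x) = (L_{u×v}(A×C))_n(x) = ((L_u A) × (L_v C))_n(x) = ((L_v A) × (L_u C))_n(x). -/

import Mathlib

open Finset MeasureTheory

/-- The `k`-th forward difference of `f : ℝ → ℝ`:
`Δ^k f(x) = ∑_{j=0}^k C(k,j) (-1)^(k-j) f(x+j)`. -/
noncomputable def fdiff (k : ℕ) (f : ℝ → ℝ) (x : ℝ) : ℝ :=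
  ∑ j ∈ Finset.range (k + 1), (k.choose j : ℝ) * (-1 : ℝ) ^ (k - j) * f (x + j)

/-- The `k`-th forward difference of a real polynomial, as a polynomial;
its evaluation at `x` is `∑_{j=0}^k C(k,j) (-1)^(k-j) p(x+j)`. -/
noncomputable def fdiffP (k : ℕ) (p : Polynomial ℝ) : Polynomial ℝ :=
  ∑ j ∈ Finset.range (k + 1),
    ((k.choose j : ℝ) * (-1 : ℝ) ^ (k - j)) • p.comp (Polynomial.X + Polynomial.C (j : ℝ))

/-- An Appell sequence of real polynomials: `A 0` is a nonzero constant and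
`A n' = n • A (n-1)` for `n ≥ 1`. -/
def IsAppell (A : ℕ → Polynomial ℝ) : Prop :=
  (A 0).eval 0 ≠ 0 ∧ (∃ c : ℝ, A 0 = Polynomial.C c) ∧
    ∀ n : ℕ, (A (n + 1)).derivative = ((n : ℝ) + 1) • A n

/-- The forward difference transformation `L_u A`, with
`(L_u A)_n(x) = ∑_{k=0}^n (u_k/k!) Δ^k A_n(x)`. -/
noncomputable def LP (u : ℕ → ℝ) (A : ℕ → Polynomial ℝ) (n : ℕ) : Polynomial ℝ :=
  ∑ k ∈ Finset.range (n + 1), (u k / (k.factorial : ℝ)) • fdiffP k (A n)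

/-- Binomial convolution of real sequences. -/
noncomputable def bconv (u v : ℕ → ℝ) (n : ℕ) : ℝ :=
  ∑ k ∈ Finset.range (n + 1), (n.choose k : ℝ) * u k * v (n - k)

/-- Binomial convolution of Appell sequences:
`(A×C)_n(x) = ∑_{k=0}^n C(n,k) A_k(0) C_{n-k}(x)`. -/
noncomputable def aconv (A C : ℕ → Polynomial ℝ) (n : ℕ) : Polynomial ℝ :=
  ∑ k ∈ Finset.range (n + 1), ((n.choose k : ℝ) * (A k).eval 0) • C (n - k)

/-- Stirling numbers of the second kind (real-valued):
`S(n,k) = (1/k!) ∑_{j=0}^k (-1)^(k-j) C(k,j) j^n`. -/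
noncomputable def stirling2 (n k : ℕ) : ℝ :=
  (1 / (k.factorial : ℝ)) *
    ∑ j ∈ Finset.range (k + 1), (-1 : ℝ) ^ (k - j) * (k.choose j : ℝ) * (j : ℝ) ^ n

/-- Signed Stirling numbers of the first kind: the coefficient of `x^k` in
`x(x-1)⋯(x-n+1)`. -/
noncomputable def stirling1 (n k : ℕ) : ℝ :=
  (∏ i ∈ Finset.range n, (Polynomial.X - Polynomial.C (i : ℝ))).coeff k

/-- Generalized binomial coefficient `C(y,k) = y(y-1)⋯(y-k+1)/k!`. -/
noncomputable def rchoose (y : ℝ) (k : ℕ) : ℝ :=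
  (∏ i ∈ Finset.range k, (y - i)) / (k.factorial : ℝ)

/-- Apostol-Euler polynomials `E_n(β;x) = ∑_{k=0}^n (-β)^k Δ^k I_n(x)`. -/
noncomputable def apostolEuler (β : ℝ) (n : ℕ) (x : ℝ) : ℝ :=
  ∑ k ∈ Finset.range (n + 1), (-β) ^ k * fdiff k (fun y => y ^ n) x

/-- Harmonic numbers `H_j = ∑_{i=1}^j 1/i`. -/
noncomputable def harm (j : ℕ) : ℝ := ∑ i ∈ Finset.range j, (1 : ℝ) / (i + 1)

open Polynomial in
/-- The forward difference `p(X) ↦ p(X + 1) - p(X)` as an endomorphism of `ℝ[X]`. -/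
noncomputable def fwdEnd : Module.End ℝ ℝ[X] := taylor 1 - 1

open Polynomial in
/-- The polynomial `∑_{k=0}^n (u_k/k!) X^k`. -/
noncomputable def egfTrunc (u : ℕ → ℝ) (n : ℕ) : ℝ[X] :=
  ∑ k ∈ Finset.range (n + 1), C (u k / (k.factorial : ℝ)) * X ^ k

open Polynomial in
lemma taylor_one_pow (m : ℕ) :
    ((taylor (1 : ℝ) : Module.End ℝ ℝ[X]) ^ m) = taylor (m : ℝ) := by
  induction m with
  | zero => exact LinearMap.ext fun p => by simp
  | succ m ih =>
    refine LinearMap.ext fun p => ?_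
    rw [pow_succ, ih, Module.End.mul_apply, taylor_taylor]
    push_cast
    rfl

lemma fdiffP_eq_fwdEnd_pow (k : ℕ) (p : Polynomial ℝ) : fdiffP k p = (fwdEnd ^ k) p := by
  have h : Commute (Polynomial.taylor (1 : ℝ) : Module.End ℝ (Polynomial ℝ))
      (-1 : Module.End ℝ (Polynomial ℝ)) :=
    LinearMap.ext fun p => by simp [Module.End.mul_apply]
  rw [fwdEnd, sub_eq_add_neg, h.add_pow, LinearMap.sum_apply, fdiffP]
  refine Finset.sum_congr rfl fun j _ => ?_
  have h1 : (-1 : Module.End ℝ (Polynomial ℝ)) ^ (k - j) * ((k.choose j : ℕ) : Module.End ℝ _)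
      = algebraMap ℝ _ ((k.choose j : ℝ) * (-1 : ℝ) ^ (k - j)) := by
    rw [mul_comm (k.choose j : ℝ)]
    simp
  rw [mul_assoc, h1, taylor_one_pow, Module.End.mul_apply, Module.algebraMap_end_apply, map_smul,
    Polynomial.taylor_apply]

open Polynomial in
lemma LP_eq_aeval (u : ℕ → ℝ) (A : ℕ → ℝ[X]) (n : ℕ) :
    LP u A n = aeval fwdEnd (egfTrunc u n) (A n) := by
  simp only [LP, egfTrunc, map_sum, map_mul, map_pow, aeval_C, aeval_X, LinearMap.sum_apply,
    Module.End.mul_apply, Module.algebraMap_end_apply, fdiffP_eq_fwdEnd_pow]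

open Polynomial in
lemma coeff_egfTrunc (u : ℕ → ℝ) {n d : ℕ} (h : d ≤ n) :
    (egfTrunc u n).coeff d = u d / (d.factorial : ℝ) := by
  simp [egfTrunc, finsetSum_coeff, coeff_X_pow, Nat.lt_succ_of_le h]

open Polynomial in
lemma X_pow_dvd_egfTrunc_sub (u : ℕ → ℝ) {m n : ℕ} (h : m ≤ n) :
    X ^ (m + 1) ∣ egfTrunc u n - egfTrunc u m := by
  refine X_pow_dvd_iff.2 fun d hd => ?_
  rw [coeff_sub, coeff_egfTrunc u (by omega), coeff_egfTrunc u (by omega), sub_self]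

open Polynomial in
lemma X_pow_dvd_egfTrunc_mul_sub (u v : ℕ → ℝ) (n : ℕ) :
    X ^ (n + 1) ∣ egfTrunc u n * egfTrunc v n - egfTrunc (bconv u v) n := by
  refine X_pow_dvd_iff.2 fun d hd => ?_
  rw [coeff_sub, coeff_mul, coeff_egfTrunc _ (by omega), sub_eq_zero, bconv,
    Finset.Nat.sum_antidiagonal_eq_sum_range_succ_mk, Finset.sum_div]
  refine Finset.sum_congr rfl fun k hk => ?_
  have hk' : k ≤ d := Nat.lt_succ_iff.1 (Finset.mem_range.1 hk)
  rw [coeff_egfTrunc u (by omega), coeff_egfTrunc v (by omega), Nat.cast_choose ℝ hk']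
  field_simp

open Polynomial in
lemma aeval_fwdEnd_eq_of_dvd_sub {p q r : ℝ[X]} {m : ℕ} (h : X ^ m ∣ p - q)
    (hr : (fwdEnd ^ m) r = 0) : aeval fwdEnd p r = aeval fwdEnd q r := by
  obtain ⟨s, hs⟩ := h
  rw [← sub_eq_zero, ← LinearMap.sub_apply, ← map_sub, hs, mul_comm, map_mul, map_pow, aeval_X,
    Module.End.mul_apply, hr, map_zero]

open Polynomial in
lemma derivative_fwdEnd_pow (k : ℕ) (p : ℝ[X]) :
    derivative ((fwdEnd ^ k) p) = (fwdEnd ^ k) (derivative p) := by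
  induction k generalizing p with
  | zero => simp
  | succ k ih =>
    rw [pow_succ, Module.End.mul_apply, Module.End.mul_apply, ih]
    congr 1
    simp [fwdEnd, taylor_apply, derivative_comp]

lemma fwdEnd_C (c : ℝ) : fwdEnd (Polynomial.C c) = 0 := by
  simp [fwdEnd]

lemma IsAppell.fwdEnd_pow_succ {A : ℕ → Polynomial ℝ} (hA : IsAppell A) (n : ℕ) :
    (fwdEnd ^ (n + 1)) (A n) = 0 := by
  induction n with
  | zero =>
    obtain ⟨c, hc⟩ := hA.2.1
    rw [zero_add, pow_one, hc, fwdEnd_C]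
  | succ n ih =>
    have h : Polynomial.derivative ((fwdEnd ^ (n + 1)) (A (n + 1))) = 0 := by
      rw [derivative_fwdEnd_pow, hA.2.2, map_smul, ih, smul_zero]
    rw [pow_succ', Module.End.mul_apply, Polynomial.eq_C_of_derivative_eq_zero h, fwdEnd_C]

lemma fwdEnd_pow_eq_zero_of_le {p : Polynomial ℝ} {m n : ℕ} (h : m ≤ n)
    (hp : (fwdEnd ^ m) p = 0) : (fwdEnd ^ n) p = 0 := by
  rw [← Nat.sub_add_cancel h, pow_add, Module.End.mul_apply, hp, map_zero]

lemma fwdEnd_pow_succ_aconv (A : ℕ → Polynomial ℝ) {C : ℕ → Polynomial ℝ} (hC : IsAppell C)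
    (n : ℕ) : (fwdEnd ^ (n + 1)) (aconv A C n) = 0 := by
  rw [aconv, map_sum]
  refine Finset.sum_eq_zero fun k _ => ?_
  rw [map_smul, fwdEnd_pow_eq_zero_of_le (m := n - k + 1) (by omega) (hC.fwdEnd_pow_succ _),
    smul_zero]

lemma IsAppell.LP_eq_aeval_of_le {A : ℕ → Polynomial ℝ} (hA : IsAppell A) (u : ℕ → ℝ) {m n : ℕ}
    (h : m ≤ n) : LP u A m = Polynomial.aeval fwdEnd (egfTrunc u n) (A m) := by
  rw [LP_eq_aeval]
  exact (aeval_fwdEnd_eq_of_dvd_sub (X_pow_dvd_egfTrunc_sub u h) (hA.fwdEnd_pow_succ m)).symm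

open Polynomial in
lemma IsAppell.sum_choose_eval_mul_eval_sub {A C : ℕ → ℝ[X]} (hA : IsAppell A)
    (hC : IsAppell C) (n : ℕ) (y z : ℝ) :
    ∑ k ∈ Finset.range (n + 1), (n.choose k : ℝ) * (A k).eval y * (C (n - k)).eval (z - y) =
      ∑ k ∈ Finset.range (n + 1), (n.choose k : ℝ) * (A k).eval 0 * (C (n - k)).eval z := by
  obtain ⟨a, ha⟩ := hA.2.1
  obtain ⟨c, hc⟩ := hC.2.1
  set P : ℝ[X] := ∑ k ∈ Finset.range (n + 1),
    (n.choose k : ℝ) • (A k * (C (n - k)).comp (Polynomial.C z - X)) with hP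
  have hd : derivative P = 0 := by
    cases n with
    | zero => simp [hP, ha, hc]
    | succ n =>
      simp only [hP, derivative_sum, derivative_smul, derivative_mul, smul_add,
        Finset.sum_add_distrib]
      rw [Finset.sum_range_succ', Finset.sum_range_succ _ (n + 1)]
      simp only [Nat.sub_self, ha, hc, C_comp, derivative_C, mul_zero, zero_mul, smul_zero,
        add_zero]
      rw [← Finset.sum_add_distrib]
      refine Finset.sum_eq_zero fun k hk => ?_
      have hk' : k ≤ n := Nat.lt_succ_iff.1 (Finset.mem_range.1 hk)
      have h1 : n + 1 - k = (n - k) + 1 := by omega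
      have h2 : ((n + 1).choose (k + 1) : ℝ) * (k + 1) =
          (n + 1).choose k * (((n - k : ℕ) : ℝ) + 1) := by
        have := Nat.choose_succ_right_eq (n + 1) k
        rw [h1] at this
        exact_mod_cast this
      rw [Nat.add_sub_add_right, h1, derivative_comp, hA.2.2, hC.2.2]
      simp only [derivative_sub, derivative_C, derivative_X, zero_sub, smul_comp, smul_mul_assoc,
        mul_smul_comm, smul_smul, h2, neg_mul, one_mul, mul_neg, smul_neg, add_neg_cancel]
  have h : ∀ w, P.eval w =
      ∑ k ∈ Finset.range (n + 1), (n.choose k : ℝ) * (A k).eval w * (C (n - k)).eval (z - w) := by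
    intro w
    simp [hP, eval_finsetSum, mul_assoc]
  have h0 := h 0
  rw [sub_zero] at h0
  rw [← h, ← h0, eq_C_of_derivative_eq_zero hd, eval_C, eval_C]

open Polynomial in
lemma IsAppell.sum_choose_aeval_taylor {A C : ℕ → ℝ[X]} (hA : IsAppell A) (hC : IsAppell C)
    (q : ℝ[X]) (n : ℕ) :
    ∑ k ∈ Finset.range (n + 1), ((n.choose k : ℝ) *
        (aeval (taylor (1 : ℝ) : Module.End ℝ ℝ[X]) q (A k)).eval 0) • C (n - k) =
      aeval (taylor (1 : ℝ) : Module.End ℝ ℝ[X]) q (aconv A C n) := by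
  induction q using Polynomial.induction_on' with
  | add p q hp hq =>
    simp only [map_add, LinearMap.add_apply, eval_add, mul_add, add_smul,
      Finset.sum_add_distrib, hp, hq]
  | monomial m b =>
    refine Polynomial.funext fun x => ?_
    have h := hA.sum_choose_eval_mul_eval_sub hC n m (x + m)
    rw [add_sub_cancel_right] at h
    simp only [aeval_monomial, taylor_one_pow, Module.End.mul_apply, Module.algebraMap_end_apply,
      aconv, eval_smul, eval_finsetSum, taylor_eval, smul_eq_mul, zero_add, ← h,
      Finset.mul_sum]
    exact Finset.sum_congr rfl fun k _ => by ring

open Polynomial in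
lemma IsAppell.sum_choose_aeval_fwdEnd {A C : ℕ → ℝ[X]} (hA : IsAppell A) (hC : IsAppell C)
    (q : ℝ[X]) (n : ℕ) :
    ∑ k ∈ Finset.range (n + 1), ((n.choose k : ℝ) * (aeval fwdEnd q (A k)).eval 0) • C (n - k) =
      aeval fwdEnd q (aconv A C n) := by
  have h : aeval fwdEnd q = aeval (taylor (1 : ℝ) : Module.End ℝ ℝ[X]) (q.comp (X - 1)) := by
    simp [aeval_comp, fwdEnd]
  rw [h, hA.sum_choose_aeval_taylor hC]

lemma IsAppell.aconv_LP_LP {A C : ℕ → Polynomial ℝ} (hA : IsAppell A) (hC : IsAppell C)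
    (u v : ℕ → ℝ) (n : ℕ) : aconv (LP u A) (LP v C) n = LP v (LP u (aconv A C)) n := by
  rw [LP_eq_aeval, LP_eq_aeval, ← hA.sum_choose_aeval_fwdEnd hC, map_sum, aconv]
  refine Finset.sum_congr rfl fun k hk => ?_
  rw [map_smul, hA.LP_eq_aeval_of_le u (Nat.lt_succ_iff.1 (Finset.mem_range.1 hk)),
    hC.LP_eq_aeval_of_le v (Nat.sub_le n k)]

lemma LP_comm (u v : ℕ → ℝ) (A : ℕ → Polynomial ℝ) (n : ℕ) :
    LP u (LP v A) n = LP v (LP u A) n := by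
  simp only [LP_eq_aeval, ← Module.End.mul_apply, ← map_mul, mul_comm]

/-- forward difference transformations commute with each other and with
binomial convolution. -/
theorem LP_comm_and_conv (A C : ℕ → Polynomial ℝ) (hA : IsAppell A) (hC : IsAppell C)
    (u v : ℕ → ℝ) (n : ℕ) (x : ℝ) :
    (LP u (LP v (aconv A C)) n).eval x = (LP v (LP u (aconv A C)) n).eval x ∧
    (LP u (LP v (aconv A C)) n).eval x = (LP (bconv u v) (aconv A C) n).eval x ∧
    (LP u (LP v (aconv A C)) n).eval x = (aconv (LP u A) (LP v C) n).eval x ∧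
    (LP u (LP v (aconv A C)) n).eval x = (aconv (LP v A) (LP u C) n).eval x := by
  have hcomm := LP_comm u v (aconv A C) n
  refine ⟨by rw [hcomm], ?_, by rw [hA.aconv_LP_LP hC, hcomm], by rw [hA.aconv_LP_LP hC]⟩
  simp only [LP_eq_aeval]
  rw [← Module.End.mul_apply, ← map_mul, aeval_fwdEnd_eq_of_dvd_sub
    (X_pow_dvd_egfTrunc_mul_sub u v n) (fwdEnd_pow_succ_aconv A hC n)]
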